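/- For every q ∈ [0,1], every 1 ≤ k ≤ n, every σ ∈ S_n and every ρ ∈ S_k: ∑_{τ ∈ S_n : std(τ_{n−k+1},…,τ_n) = ρ} K_n^q(σ,τ) = K_k^q(std(σ_{n−k+1},…,σ_n), ρ). That is, observing the standardisation of the last k entries of the binomial-top-to-random-with-standardisation chain on S_n is a Markov chain equal to the binomial-top-to-random-with-standardisation chain on S_k with the same parameter q. -/

import Mathlib

open scoped Classical

noncomputable section

/-- The standardisation (rank function) of a word `w = (w 0, …, w (m-1))` of distinct
letters from a linear order: position `a` is sent to the number of positions carrying a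
smaller letter (so, `0`-indexed ranks). -/
def std {m : ℕ} {α : Type*} [LinearOrder α] (w : Fin m → α) : Fin m → Fin m :=
  fun a =>
    ⟨(Finset.univ.filter (fun b => w b < w a)).card, by
      have ha : a ∉ Finset.univ.filter (fun b => w b < w a) := by simp
      have h := Finset.card_lt_card
        ((Finset.ssubset_iff_of_subset (Finset.filter_subset _ _)).2
          ⟨a, Finset.mem_univ a, ha⟩)
      simpa using h⟩

/-- `subMatch n r σ τ` says: the subsequence of the word `(τ 0, …, τ (n-1))` consisting of
the entries with values `≥ r` (`0`-indexed; these are the values `{r+1,…,n}` in `1`-indexed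
notation) has the same standardisation as the word `(σ r, …, σ (n-1))`.
Here `g` is the (unique) strictly increasing enumeration of the relevant positions. -/
def subMatch (n r : ℕ) (σ τ : Equiv.Perm (Fin n)) : Prop :=
  ∃ g : Fin (n - r) → Fin n, StrictMono g ∧
    (∀ p : Fin n, (∃ a, g a = p) ↔ r ≤ (τ p : ℕ)) ∧
    std (fun a => τ (g a)) =
      std (fun a : Fin (n - r) => σ ⟨r + (a : ℕ), by have := a.isLt; omega⟩)

/-- The top-to-random-with-standardisation transition matrix on `S_n`. -/
def Ktr (n : ℕ) : Matrix (Equiv.Perm (Fin n)) (Equiv.Perm (Fin n)) ℝ :=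
  Matrix.of fun σ τ => if subMatch n 1 σ τ then 1 / (n : ℝ) else 0

/-- The binomial-top-to-random-with-standardisation transition matrix on `S_n`,
with parameter `q`. -/
def Kq (n : ℕ) (q : ℝ) : Matrix (Equiv.Perm (Fin n)) (Equiv.Perm (Fin n)) ℝ :=
  Matrix.of fun σ τ =>
    ∑ r ∈ Finset.range (n + 1),
      ((1 - q) ^ r * q ^ (n - r) / (r.factorial : ℝ)) *
        (if subMatch n r σ τ then 1 else 0)

/-- The word `(σ_{j+1}, …, σ_n)` (0-indexed: the entries of `σ` at positions `j,…,n-1`). -/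
def tailWord (n j : ℕ) (σ : Equiv.Perm (Fin n)) : Fin (n - j) → Fin n :=
  fun a => σ ⟨j + (a : ℕ), by have := a.isLt; omega⟩

/-- The word `(j+1, τ_{j+1}, …, τ_{i-1}, τ_{i+1}, …, τ_n)` (0-indexed: first letter the
value `j`, followed by the entries of `τ` at positions `j,…,n-1` skipping position `i`). -/
def wMinus (n j : ℕ) (i : Fin n) (τ : Equiv.Perm (Fin n)) : Fin (n - j) → Fin n :=
  fun a =>
    if (a : ℕ) = 0 then ⟨j, by have := a.isLt; omega⟩
    else if j + (a : ℕ) - 1 < (i : ℕ) then τ ⟨j + (a : ℕ) - 1, by have := a.isLt; omega⟩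
    else τ ⟨j + (a : ℕ), by have := a.isLt; omega⟩

/-- The eigenfunction `f_τ` attached to a non-identity permutation `τ`, where `j` is the
number of initial fixed points of `τ` and `i` is the position of the value `j` in `τ`. -/
def fTau (n j : ℕ) (i : Fin n) (τ σ : Equiv.Perm (Fin n)) : ℝ :=
  if std (tailWord n j σ) = std (tailWord n j τ) then 1
  else if std (tailWord n j σ) = std (wMinus n j i τ) then -1
  else 0


theorem std_lt_std {m : ℕ} {α : Type*} [LinearOrder α] (w : Fin m → α) (a b : Fin m) :
    std w a < std w b ↔ w a < w b := by
  have mono : ∀ x y, w x ≤ w y → std w x ≤ std w y := fun x y h => by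
    change (Finset.univ.filter fun c => w c < w x).card ≤
      (Finset.univ.filter fun c => w c < w y).card
    exact Finset.card_le_card fun c hc => by
      simp only [Finset.mem_filter, Finset.mem_univ, true_and] at hc ⊢
      exact hc.trans_le h
  refine ⟨fun h => ?_, fun h => ?_⟩
  · contrapose! h
    exact mono _ _ h
  · change (Finset.univ.filter fun c => w c < w a).card <
      (Finset.univ.filter fun c => w c < w b).card
    refine Finset.card_lt_card ((Finset.ssubset_iff_of_subset fun c hc => ?_).2 ⟨a, ?_, ?_⟩)
    · simp only [Finset.mem_filter, Finset.mem_univ, true_and] at hc ⊢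
      exact hc.trans h
    · simpa using h
    · simp

theorem std_eq_std_iff {m : ℕ} {α β : Type*} [LinearOrder α] [LinearOrder β]
    (u : Fin m → α) (w : Fin m → β) :
    std u = std w ↔ ∀ a b, u a < u b ↔ w a < w b := by
  refine ⟨fun h a b => ?_, fun h => ?_⟩
  · rw [← std_lt_std u, h, std_lt_std]
  · funext a
    simp only [std, h]

theorem std_perm {m : ℕ} (τ : Equiv.Perm (Fin m)) : std τ = τ := by
  funext a
  rw [Fin.ext_iff]
  change (Finset.univ.filter fun b => τ b < τ a).card = _
  rw [← Finset.card_map τ.toEmbedding]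
  have : (Finset.univ.filter fun b => τ b < τ a).map τ.toEmbedding = Finset.Iio (τ a) := by
    ext c
    simp only [Finset.mem_map_equiv, Finset.mem_filter, Finset.mem_univ, true_and,
      Equiv.apply_symm_apply, Finset.mem_Iio]
  rw [this, Fin.card_Iio]

/-- The standardisation of a word with distinct letters, as a permutation. -/
def stdPerm {m : ℕ} {α : Type*} [LinearOrder α] (w : Fin m → α) (hw : Function.Injective w) :
    Equiv.Perm (Fin m) :=
  Equiv.ofBijective (std w) <| Finite.injective_iff_bijective.1 fun a b h => hw <| by
    refine le_antisymm ?_ ?_ <;> rw [← not_lt, ← std_lt_std w, h] <;> exact lt_irrefl _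

theorem stdPerm_lt_stdPerm {m : ℕ} {α : Type*} [LinearOrder α] (w : Fin m → α)
    (hw : Function.Injective w) (a b : Fin m) :
    stdPerm w hw a < stdPerm w hw b ↔ w a < w b :=
  std_lt_std w a b

/-- The permutation with first letter `v` whose remaining letters standardise to `ρ`. -/
def consPerm {m : ℕ} (v : Fin (m + 1)) (ρ : Equiv.Perm (Fin m)) : Equiv.Perm (Fin (m + 1)) :=
  ((finSuccEquiv m).trans (Equiv.optionCongr ρ)).trans (finSuccEquiv' v).symm

@[simp] theorem consPerm_zero {m : ℕ} (v : Fin (m + 1)) (ρ : Equiv.Perm (Fin m)) :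
    consPerm v ρ 0 = v := by
  simp [consPerm]

@[simp] theorem consPerm_succ {m : ℕ} (v : Fin (m + 1)) (ρ : Equiv.Perm (Fin m)) (i : Fin m) :
    consPerm v ρ i.succ = v.succAbove (ρ i) := by
  simp [consPerm]

theorem consPerm_bijective (m : ℕ) :
    Function.Bijective fun p : Fin (m + 1) × Equiv.Perm (Fin m) => consPerm p.1 p.2 := by
  refine (Fintype.bijective_iff_injective_and_card _).2 ⟨?_, ?_⟩
  · rintro ⟨v, ρ⟩ ⟨v', ρ'⟩ h
    have hv : v = v' := by simpa using congrArg (fun τ => τ 0) h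
    subst hv
    refine Prod.ext rfl (Equiv.ext fun i => ?_)
    simpa using congrArg (fun τ => τ i.succ) h
  · simp [Fintype.card_perm, Nat.factorial_succ]

theorem sum_perm_succ {m : ℕ} (f : Equiv.Perm (Fin (m + 1)) → ℝ) :
    ∑ τ, f τ = ∑ ρ : Equiv.Perm (Fin m), ∑ v, f (consPerm v ρ) := by
  rw [← (Equiv.ofBijective _ (consPerm_bijective m)).sum_comp f, Fintype.sum_prod_type_right]
  rfl

theorem subMatch_iff {n r L : ℕ} (h : n = r + L) (σ τ : Equiv.Perm (Fin n)) :
    subMatch n r σ τ ↔ ∃ g : Fin L → Fin n, StrictMono g ∧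
      (∀ p : Fin n, (∃ a, g a = p) ↔ r ≤ (τ p : ℕ)) ∧
      ∀ a b : Fin L, τ (g a) < τ (g b) ↔
        σ ⟨r + a, by have := a.isLt; omega⟩ < σ ⟨r + b, by have := b.isLt; omega⟩ := by
  obtain rfl : L = n - r := by omega
  simp only [subMatch, std_eq_std_iff]

theorem le_succAbove_iff_of_le {m r : ℕ} {v : Fin (m + 1)} (hv : r ≤ (v : ℕ)) (i : Fin m) :
    r ≤ (v.succAbove i : ℕ) ↔ r ≤ (i : ℕ) := by
  simp only [Fin.succAbove, Fin.lt_def, Fin.val_castSucc]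
  split_ifs <;> simp only [Fin.val_castSucc, Fin.val_succ] <;> omega

theorem succ_le_succAbove_iff_of_le {m r : ℕ} {v : Fin (m + 1)} (hv : (v : ℕ) ≤ r) (i : Fin m) :
    r + 1 ≤ (v.succAbove i : ℕ) ↔ r ≤ (i : ℕ) := by
  simp only [Fin.succAbove, Fin.lt_def, Fin.val_castSucc]
  split_ifs <;> simp only [Fin.val_castSucc, Fin.val_succ] <;> omega

/-- When the first letter of `τ` is a removed value, it plays no role in the match. -/
theorem subMatch_consPerm_of_le {m s : ℕ} (hs : s ≤ m) {v : Fin (m + 1)} (hv : (v : ℕ) ≤ s)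
    (σ : Equiv.Perm (Fin (m + 1))) (σ' ρ : Equiv.Perm (Fin m))
    (hσ : ∀ i j, σ' i < σ' j ↔ σ i.succ < σ j.succ) :
    subMatch (m + 1) (s + 1) σ (consPerm v ρ) ↔ subMatch m s σ' ρ := by
  obtain ⟨L, rfl⟩ := Nat.exists_eq_add_of_le hs
  rw [subMatch_iff (L := L) (by omega), subMatch_iff (L := L) rfl]
  have hidx : ∀ a : Fin L, (⟨s + 1 + a, by omega⟩ : Fin (s + L + 1)) =
      Fin.succ ⟨s + a, by omega⟩ := fun a => Fin.ext (by simp; omega)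
  simp only [hidx, ← hσ]
  constructor
  · rintro ⟨g, hg, hr, ho⟩
    have hne : ∀ a, g a ≠ 0 := fun a h0 => by
      have := (hr 0).1 ⟨a, h0⟩
      rw [consPerm_zero] at this
      omega
    obtain ⟨g', rfl⟩ : ∃ g' : Fin L → Fin (s + L), g = fun a => (g' a).succ :=
      ⟨fun a => (g a).pred (hne a), by simp⟩
    refine ⟨g', fun a b h => Fin.succ_lt_succ_iff.1 (hg h), fun p => ?_, fun a b => ?_⟩
    · simpa [succ_le_succAbove_iff_of_le hv] using hr p.succ
    · simpa using ho a b
  · rintro ⟨g, hg, hr, ho⟩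
    refine ⟨fun a => (g a).succ, fun a b h => Fin.succ_lt_succ_iff.2 (hg h), fun p => ?_,
      fun a b => by simpa using ho a b⟩
    cases p using Fin.cases with
    | zero => simp [Fin.succ_ne_zero]; omega
    | succ p => simpa [succ_le_succAbove_iff_of_le hv] using hr p

/-- When the first letter `v` of `τ` is kept, a match amounts to a match of the remaining
letters together with `v` separating them as prescribed by `σ`. -/
theorem subMatch_consPerm_of_ge {r L : ℕ} {v : Fin (r + L + 1)} (hv : r ≤ (v : ℕ))
    (σ : Equiv.Perm (Fin (r + L + 1))) (σ' ρ : Equiv.Perm (Fin (r + L)))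
    (hσ : ∀ i j, σ' i < σ' j ↔ σ i.succ < σ j.succ) :
    subMatch (r + L + 1) r σ (consPerm v ρ) ↔ ∃ g : Fin L → Fin (r + L), StrictMono g ∧
      (∀ p, (∃ a, g a = p) ↔ r ≤ (ρ p : ℕ)) ∧
      (∀ a b : Fin L, ρ (g a) < ρ (g b) ↔ σ' ⟨r + a, by omega⟩ < σ' ⟨r + b, by omega⟩) ∧
      ∀ b : Fin L, (v : ℕ) ≤ ρ (g b) ↔
        σ ⟨r, by omega⟩ < σ (Fin.succ ⟨r + b, by omega⟩) := by
  rw [subMatch_iff (L := L + 1) (by omega)]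
  have hidx : ∀ a : Fin L, (⟨r + (a.succ : Fin (L + 1)), by simp⟩ : Fin (r + L + 1)) =
      Fin.succ ⟨r + a, by omega⟩ := fun a => Fin.ext (by simp; omega)
  have hlt : ∀ i : Fin (r + L), v < v.succAbove i ↔ (v : ℕ) ≤ i := fun i => by
    rw [Fin.lt_succAbove_iff_le_castSucc, Fin.le_def, Fin.val_castSucc]
  constructor
  · rintro ⟨g, hg, hr, ho⟩
    have h0 : g 0 = 0 := by
      obtain ⟨a, ha⟩ := (hr 0).2 (by simpa using hv)
      exact le_antisymm (ha ▸ hg.monotone (Fin.zero_le a)) (Fin.zero_le _)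
    have hne : ∀ a : Fin L, g a.succ ≠ 0 := fun a h =>
      Fin.succ_ne_zero a (hg.injective (h.trans h0.symm))
    have hs : ∀ a : Fin L, g a.succ = ((g a.succ).pred (hne a)).succ := fun a => by simp
    refine ⟨fun a => (g a.succ).pred (hne a), fun a b h => ?_, fun p => ?_, fun a b => ?_,
      fun b => ?_⟩
    · exact Fin.pred_lt_pred_iff.2 (hg (Fin.succ_lt_succ_iff.2 h))
    · rw [← le_succAbove_iff_of_le hv, ← consPerm_succ, ← hr]
      constructor
      · rintro ⟨a, rfl⟩
        exact ⟨a.succ, by simp⟩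
      · rintro ⟨a, ha⟩
        cases a using Fin.cases with
        | zero => exact absurd (h0.symm.trans ha).symm (Fin.succ_ne_zero p)
        | succ a => exact ⟨a, by simp [ha]⟩
    · have := ho a.succ b.succ
      rw [hidx, hidx, ← hσ, hs a, hs b, consPerm_succ, consPerm_succ] at this
      simpa only [Fin.succAbove_lt_succAbove_iff] using this
    · have := ho 0 b.succ
      rw [hidx, h0, hs b, consPerm_zero, consPerm_succ, hlt] at this
      simpa using this
  · rintro ⟨g, hg, hr, ho, hb⟩
    refine ⟨Fin.cons 0 fun a => (g a).succ, ?_, fun p => ?_, fun a b => ?_⟩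
    · intro a b hab
      cases b using Fin.cases with
      | zero => exact absurd hab (Fin.not_lt_zero a)
      | succ b =>
        cases a using Fin.cases with
        | zero => simp
        | succ a => simpa using hg (Fin.succ_lt_succ_iff.1 hab)
    · cases p using Fin.cases with
      | zero => simpa [hv] using ⟨0, by simp⟩
      | succ p => simpa [le_succAbove_iff_of_le hv, Fin.exists_fin_succ, (Fin.succ_ne_zero _).symm]
          using hr p
    · have hb' : ∀ c : Fin L, v.succAbove (ρ (g c)) < v ↔
          σ (Fin.succ ⟨r + c, by omega⟩) < σ ⟨r, by omega⟩ := fun c => by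
        rw [← not_iff_not, not_lt, not_lt, le_iff_lt_or_eq, hlt, hb, le_iff_lt_or_eq,
          or_iff_left (Fin.ne_succAbove _ _), or_iff_left]
        rw [σ.injective.eq_iff, Fin.ext_iff]
        simp
        omega
      cases a using Fin.cases with
      | zero =>
        cases b using Fin.cases with
        | zero => simp
        | succ b => rw [hidx]; simpa [hlt] using hb b
      | succ a =>
        cases b using Fin.cases with
        | zero => rw [hidx]; simpa using hb' a
        | succ b => rw [hidx, hidx, ← hσ]; simpa using ho a b

/-- A match of the last letters extends to a match with a kept first letter in exactly one
way. -/
theorem sum_subMatch_consPerm_of_ge {m r : ℕ} (hr : r ≤ m)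
    (σ : Equiv.Perm (Fin (m + 1))) (σ' ρ : Equiv.Perm (Fin m))
    (hσ : ∀ i j, σ' i < σ' j ↔ σ i.succ < σ j.succ) :
    ∑ v : Fin (m + 1), (if r ≤ (v : ℕ) ∧ subMatch (m + 1) r σ (consPerm v ρ) then (1 : ℝ) else 0)
      = if subMatch m r σ' ρ then 1 else 0 := by
  obtain ⟨L, rfl⟩ := Nat.exists_eq_add_of_le hr
  split_ifs with hsub
  · obtain ⟨g, hg, hrg, ho⟩ := (subMatch_iff rfl σ' ρ).1 hsub
    have hex : ∃ w, r ≤ w ∧ ∀ b : Fin L, w ≤ ρ (g b) →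
        σ ⟨r, by omega⟩ < σ (Fin.succ ⟨r + b, by omega⟩) :=
      ⟨r + L, by omega, fun b hb => by omega⟩
    have hle : Nat.find hex ≤ r + L := Nat.find_min' hex ⟨by omega, fun b hb => by omega⟩
    obtain ⟨hrw, hw⟩ := Nat.find_spec hex
    rw [Finset.sum_eq_single (⟨Nat.find hex, by omega⟩ : Fin (r + L + 1))]
    · refine if_pos ⟨hrw, (subMatch_consPerm_of_ge hrw σ σ' ρ hσ).2
        ⟨g, hg, hrg, ho, fun b => ⟨hw b, fun hb => ?_⟩⟩⟩
      refine Nat.find_min' hex ⟨(hrg _).1 ⟨b, rfl⟩, fun c hc => hb.trans_le ?_⟩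
      rw [← not_lt, ← hσ, ← ho, not_lt]
      exact hc
    · rintro v - hne
      refine if_neg fun ⟨hv, hm⟩ => hne (Fin.ext ?_)
      obtain ⟨g', hg', hrg', -, hb⟩ := (subMatch_consPerm_of_ge hv σ σ' ρ hσ).1 hm
      obtain rfl : g' = g := (hg'.range_inj hg).1 <| Set.ext fun p => (hrg' p).trans (hrg p).symm
      refine le_antisymm ?_ (Nat.find_min' hex ⟨hv, fun b => (hb b).1⟩)
      by_contra! hlt
      have hlt' : Nat.find hex < v := hlt
      obtain ⟨b, hgb⟩ := (hrg' (ρ.symm ⟨Nat.find hex, by omega⟩)).2 (by simpa using hrw)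
      have hval : (ρ (g' b) : ℕ) = Nat.find hex := by rw [hgb]; simp
      have := (hb b).2 (hw b hval.ge)
      omega
    · simp
  · refine Finset.sum_eq_zero fun v _ => if_neg fun ⟨hv, hm⟩ => hsub ?_
    obtain ⟨g, hg, hrg, ho, -⟩ := (subMatch_consPerm_of_ge hv σ σ' ρ hσ).1 hm
    exact (subMatch_iff rfl σ' ρ).2 ⟨g, hg, hrg, ho⟩

theorem sum_subMatch_consPerm_of_lt {m s : ℕ} (hs : s ≤ m)
    (σ : Equiv.Perm (Fin (m + 1))) (σ' ρ : Equiv.Perm (Fin m))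
    (hσ : ∀ i j, σ' i < σ' j ↔ σ i.succ < σ j.succ) :
    ∑ v : Fin (m + 1),
        (if (v : ℕ) < s + 1 ∧ subMatch (m + 1) (s + 1) σ (consPerm v ρ) then (1 : ℝ) else 0)
      = (s + 1) * if subMatch m s σ' ρ then 1 else 0 := by
  have hcongr : ∀ v : Fin (m + 1),
      ((v : ℕ) < s + 1 ∧ subMatch (m + 1) (s + 1) σ (consPerm v ρ)) ↔
        ((v : ℕ) < s + 1 ∧ subMatch m s σ' ρ) := fun v =>
    and_congr_right fun hv => subMatch_consPerm_of_le hs (Nat.lt_succ_iff.1 hv) σ σ' ρ hσ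
  simp only [hcongr]
  split_ifs with h
  · have hcard := Fin.card_filter_val_lt (m := s + 1) (n := m + 1)
    simp only [h, and_true, Finset.sum_boole, mul_one]
    rw [min_eq_right (by omega)] at hcard
    exact_mod_cast hcard
  · simp [h]

theorem sum_Kq_consPerm {m : ℕ} (q : ℝ) (σ : Equiv.Perm (Fin (m + 1)))
    (σ' ρ : Equiv.Perm (Fin m)) (hσ : ∀ i j, σ' i < σ' j ↔ σ i.succ < σ j.succ) :
    ∑ v, Kq (m + 1) q σ (consPerm v ρ) = Kq m q σ' ρ := by
  have hsplit : ∀ (r : ℕ), ∑ v, (if subMatch (m + 1) r σ (consPerm v ρ) then (1 : ℝ) else 0) =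
      ∑ v : Fin (m + 1),
        (if (v : ℕ) < r ∧ subMatch (m + 1) r σ (consPerm v ρ) then (1 : ℝ) else 0) +
      ∑ v : Fin (m + 1),
        (if r ≤ (v : ℕ) ∧ subMatch (m + 1) r σ (consPerm v ρ) then (1 : ℝ) else 0) := fun r => by
    rw [← Finset.sum_add_distrib]
    refine Finset.sum_congr rfl fun v _ => ?_
    by_cases h : (v : ℕ) < r
    · simp [h]
    · simp [h, not_lt.1 h]
  simp only [Kq, Matrix.of_apply]
  rw [Finset.sum_comm]
  simp only [← Finset.mul_sum, hsplit, mul_add, Finset.sum_add_distrib]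
  rw [Finset.sum_range_succ' _ (m + 1), Finset.sum_range_succ _ (m + 1)]
  have hzero : ∀ P : Fin (m + 1) → Prop,
      ∑ v : Fin (m + 1), (if (v : ℕ) < 0 ∧ P v then (1 : ℝ) else 0) = 0 := fun P => by simp
  have htop : ∀ P : Fin (m + 1) → Prop,
      ∑ v : Fin (m + 1), (if m + 1 ≤ (v : ℕ) ∧ P v then (1 : ℝ) else 0) = 0 := fun P =>
    Finset.sum_eq_zero fun v _ => if_neg fun h => by omega
  rw [hzero, htop, mul_zero, mul_zero, add_zero, add_zero, ← Finset.sum_add_distrib]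
  refine Finset.sum_congr rfl fun s hs => ?_
  have hsm : s ≤ m := Nat.lt_succ_iff.1 (Finset.mem_range.1 hs)
  rw [sum_subMatch_consPerm_of_lt hsm σ σ' ρ hσ, sum_subMatch_consPerm_of_ge hsm σ σ' ρ hσ,
    Nat.succ_sub_succ, Nat.succ_sub hsm, Nat.factorial_succ, pow_succ, pow_succ]
  push_cast
  have h1 : (s.factorial : ℝ) ≠ 0 := by positivity
  have h2 : (s + 1 : ℝ) ≠ 0 := by positivity
  field_simp
  ring

/-- **Recursive lumping of the binomial-top-to-random-with-standardisation chain.**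
Observing the standardisation of the last `k` entries gives the
binomial-top-to-random-with-standardisation chain on `S_k` with the same parameter `q`.
Here `ρ'` is the standardisation of the last `k` entries of `σ` (given as a permutation
whose underlying function is that standardisation). -/
theorem binomialTopToRandomStd_recursive_lumping (n k : ℕ) (hk1 : 1 ≤ k) (hkn : k ≤ n)
    (q : ℝ) (hq0 : 0 ≤ q) (hq1 : q ≤ 1)
    (σ : Equiv.Perm (Fin n)) (ρ ρ' : Equiv.Perm (Fin k))
    (hρ' : ⇑ρ' = std (fun a : Fin k => σ ⟨n - k + (a : ℕ), by have := a.isLt; omega⟩)) :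
    ∑ τ ∈ Finset.univ.filter (fun τ : Equiv.Perm (Fin n) =>
        std (fun a : Fin k => τ ⟨n - k + (a : ℕ), by have := a.isLt; omega⟩) = ⇑ρ),
      Kq n q σ τ
    = Kq k q ρ' ρ := by
  induction n, hkn using Nat.le_induction with
  | base =>
    have hidx : ∀ a : Fin k, (⟨k - k + a, by omega⟩ : Fin k) = a := fun a => Fin.ext (by simp)
    simp only [hidx, std_perm, DFunLike.coe_fn_eq] at hρ' ⊢
    simp [hρ', Finset.filter_eq']
  | succ m hkm ih =>
    have hidx : ∀ a : Fin k, (⟨m + 1 - k + a, by omega⟩ : Fin (m + 1)) =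
        Fin.succ ⟨m - k + a, by omega⟩ := fun a => Fin.ext (by simp; omega)
    have hinj : Function.Injective fun i : Fin m => σ i.succ :=
      σ.injective.comp (Fin.succ_injective m)
    have hσ := stdPerm_lt_stdPerm _ hinj
    simp only [hidx] at hρ' ⊢
    rw [← ih (stdPerm _ hinj) (hρ'.trans ((std_eq_std_iff _ _).2 fun a b => (hσ _ _).symm)),
      Finset.sum_filter, Finset.sum_filter, sum_perm_succ]
    refine Finset.sum_congr rfl fun τ _ => ?_
    have hstd : ∀ v, std (fun a : Fin k => consPerm v τ (Fin.succ ⟨m - k + a, by omega⟩)) =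
        std fun a : Fin k => τ ⟨m - k + a, by omega⟩ := fun v =>
      (std_eq_std_iff _ _).2 fun a b => by
        simp only [consPerm_succ, Fin.succAbove_lt_succAbove_iff]
    simp only [hstd]
    split_ifs
    · exact sum_Kq_consPerm q σ _ τ hσ
    · simp

end
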